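/- arXiv:1907.12035 — 11 statements merged into one kernel-verified Lean document; each statement's English description precedes it below -/
import Mathlib

section
/- Let V = Z/nZ with n ≥ 3 be the vertex set of a cycle graph (the dual graph of the minimal resolution of a cusp singularity). For every integer k ≥ 1 and every vertex v ∈ V, taking a ∈ Z_{≥0}^V to be the vector k·δ_v (value k at v and 0 elsewhere), one has Σ_{I ⊆ V} (−1)^{|I|+1} χ(l'_a + E_{J(a,I)}) = 1. (This is the coefficient computation, case (a), proving that the coefficient of t^{kE*_v} in P(t) = Z(t) of a cusp singularity equals 1.) -/
open Finset

/-- The intersection pairing `(x, y) = xᵀ B y` on `ℚ^V` given by an integer matrix `B`. -/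
def pairQ {V : Type*} [Fintype V] (B : V → V → ℤ) (x y : V → ℚ) : ℚ :=
  ∑ i, ∑ j, x i * (B i j : ℚ) * y j

/-- The standard basis vector `e_v`. -/
def basisVec {V : Type*} [DecidableEq V] (v : V) : V → ℚ :=
  fun w => if w = v then 1 else 0

/-- `E_J = ∑_{v ∈ J} e_v` for a subset `J ⊆ V`. -/
def EJ {V : Type*} [DecidableEq V] (J : Finset V) : V → ℚ :=
  fun w => if w ∈ J then 1 else 0

/-- `χ(x) = -(x, x + K)/2`. -/
def chiQ {V : Type*} [Fintype V] (B : V → V → ℤ) (K : V → ℚ) (x : V → ℚ) : ℚ :=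
  -(pairQ B x (x + K)) / 2


lemma cusp_pair_right {V : Type*} [Fintype V] [DecidableEq V] (B : V → V → ℤ) (x y : V → ℚ) :
    pairQ B x y = ∑ v, y v * pairQ B x (basisVec v) := by
  unfold pairQ basisVec
  simp only [mul_ite, mul_one, mul_zero, Finset.sum_ite_eq', Finset.mem_univ, if_true,
    Finset.sum_ite_eq, Finset.mul_sum]
  rw [Finset.sum_comm]
  refine Finset.sum_congr rfl fun i _ => Finset.sum_congr rfl fun j _ => ?_
  ring

lemma cusp_pair_symm {V : Type*} [Fintype V] (B : V → V → ℤ)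
    (hB : ∀ i j, B i j = B j i) (x y : V → ℚ) : pairQ B x y = pairQ B y x := by
  unfold pairQ
  rw [Finset.sum_comm]
  refine Finset.sum_congr rfl fun i _ => Finset.sum_congr rfl fun j _ => ?_
  rw [hB j i]; ring

lemma cusp_pair_add_left {V : Type*} [Fintype V] (B : V → V → ℤ) (x y z : V → ℚ) :
    pairQ B (x + y) z = pairQ B x z + pairQ B y z := by
  unfold pairQ
  simp only [Pi.add_apply, add_mul, Finset.sum_add_distrib]

lemma cusp_pair_add_right {V : Type*} [Fintype V] (B : V → V → ℤ) (x y z : V → ℚ) :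
    pairQ B x (y + z) = pairQ B x y + pairQ B x z := by
  unfold pairQ
  simp only [Pi.add_apply, mul_add, Finset.sum_add_distrib]

lemma cusp_ne (n : ℕ) (hn : 3 ≤ n) (v : ZMod n) : v + 1 ≠ v ∧ v - 1 ≠ v ∧ v + 1 ≠ v - 1 := by
  have h1 : ((1 : ℕ) : ZMod n) ≠ 0 := by
    rw [Ne, ZMod.natCast_eq_zero_iff]
    intro h; have := Nat.le_of_dvd (by norm_num) h; omega
  have h2 : ((2 : ℕ) : ZMod n) ≠ 0 := by
    rw [Ne, ZMod.natCast_eq_zero_iff]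
    intro h; have := Nat.le_of_dvd (by norm_num) h; omega
  push_cast at h1 h2
  refine ⟨fun h => h1 ?_, fun h => h1 ?_, fun h => h2 ?_⟩
  · linear_combination h
  · linear_combination -h
  · linear_combination h

lemma cusp_pair_basis (n : ℕ) (hn : 3 ≤ n) [NeZero n]
    (B : ZMod n → ZMod n → ℤ)
    (hBsymm : ∀ i j, B i j = B j i)
    (hBadj : ∀ i, B i (i + 1) = 1)
    (hBoff : ∀ i j, i ≠ j → j ≠ i + 1 → j ≠ i - 1 → B i j = 0)
    (x : ZMod n → ℚ) (v : ZMod n) :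
    pairQ B x (basisVec v) = x v * B v v + x (v + 1) + x (v - 1) := by
  obtain ⟨h1, h2, h3⟩ := cusp_ne n hn v
  have key : ∀ i, (B i v : ℚ) = (if i = v then (B v v : ℚ) else 0) + (if i = v + 1 then 1 else 0)
      + (if i = v - 1 then 1 else 0) := by
    intro i
    by_cases a1 : i = v
    · subst a1; simp [h1.symm, h2.symm]
    by_cases a2 : i = v + 1
    · subst a2; rw [hBsymm, hBadj]; simp [h1, h3]
    by_cases a3 : i = v - 1
    · subst a3
      have := hBadj (v - 1)
      rw [sub_add_cancel] at this
      rw [this]; simp [h2, h3.symm]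
    · rw [hBsymm, hBoff v i (Ne.symm a1) a2 a3]; simp [a1, a2, a3]
  unfold pairQ basisVec
  simp only [mul_ite, mul_one, mul_zero, Finset.sum_ite_eq', Finset.mem_univ, if_true]
  rw [Finset.sum_congr rfl fun i _ => congrArg (fun t => x i * t) (key i)]
  simp only [mul_add, Finset.sum_add_distrib, mul_ite, mul_one, mul_zero,
    Finset.sum_ite_eq', Finset.mem_univ, if_true]

/-- propagation along the path `V \ {v0}` -/
lemma cusp_prop (n : ℕ) [NeZero n] (v0 : ZMod n) (S : Finset (ZMod n))
    (hS : ∀ v ∉ S, v ≠ v0 → v + 1 ∉ S ∧ v - 1 ∉ S) (w : ZMod n) (hw : w ∈ S) :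
    ∀ u, u ≠ v0 → u ∈ S := by
  by_contra hcon
  push Not at hcon
  obtain ⟨u, hu0, huS⟩ := hcon
  -- complement propagates up to v0 in both directions
  have up : ∀ m : ℕ, (∀ j : ℕ, j < m → u + j ≠ v0) → u + m ∉ S := by
    intro m
    induction m with
    | zero => intro _; simpa using huS
    | succ m ih =>
      intro h
      have := (hS _ (ih fun j hj => h j (by omega)) (h m (by omega))).1
      rw [Nat.cast_succ, ← add_assoc]; exact this
  have down : ∀ m : ℕ, (∀ j : ℕ, j < m → u - j ≠ v0) → u - m ∉ S := by
    intro m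
    induction m with
    | zero => intro _; simpa using huS
    | succ m ih =>
      intro h
      have := (hS _ (ih fun j hj => h j (by omega)) (h m (by omega))).2
      rw [Nat.cast_succ, ← sub_sub]; exact this
  -- w = u + p = u - (n - p), v0 = u + q
  have hp : u + ((w - u).val : ℕ) = w := by simp
  have hp' : u - ((u - w).val : ℕ) = w := by simp
  have h1 : ∃ j : ℕ, j < (w - u).val ∧ u + j = v0 := by
    by_contra hc
    push Not at hc
    exact up _ hc (by rw [hp]; exact hw)
  have h2 : ∃ j : ℕ, j < (u - w).val ∧ u - j = v0 := by
    by_contra hc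
    push Not at hc
    exact down _ hc (by rw [hp']; exact hw)
  obtain ⟨j, hj, ej⟩ := h1
  obtain ⟨i, hi, ei⟩ := h2
  have hz : ((i + j : ℕ) : ZMod n) = 0 := by
    push_cast; linear_combination ej - ei
  rw [ZMod.natCast_eq_zero_iff] at hz
  have hwu : w - u ≠ 0 := by
    intro h; rw [h] at hj; simp at hj
  have hneg : (u - w).val = n - (w - u).val := by
    rw [← neg_sub w u]
    rw [ZMod.neg_val]; simp [hwu]
  have hlt := ZMod.val_lt (w - u)
  have : i + j = 0 := Nat.eq_zero_of_dvd_of_lt hz (by omega)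
  have : j = 0 := by omega
  subst this
  apply hu0; simpa using ej

lemma cusp_chi_diff (n : ℕ) (hn : 3 ≤ n) [NeZero n]
    (B : ZMod n → ZMod n → ℤ)
    (hBsymm : ∀ i j, B i j = B j i)
    (hBadj : ∀ i, B i (i + 1) = 1)
    (hBoff : ∀ i j, i ≠ j → j ≠ i + 1 → j ≠ i - 1 → B i j = 0)
    (K : ZMod n → ℚ)
    (hK : ∀ v, pairQ B (K + basisVec v) (basisVec v) = -2)
    (a : ZMod n → ℕ)
    (lpa : ZMod n → ℚ)
    (hlpa : ∀ v, pairQ B lpa (basisVec v) = -(a v : ℚ)) (x : ZMod n → ℚ) :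
    chiQ B K (lpa + x) - chiQ B K lpa =
      ∑ v, x v * (a v - (x v * B v v + x (v + 1) + x (v - 1) - 2 - B v v) / 2) := by
  have hKv : ∀ v, pairQ B K (basisVec v) = -2 - B v v := by
    intro v
    have h := hK v
    obtain ⟨h1, h2, h3⟩ := cusp_ne n hn v
    rw [cusp_pair_add_left, cusp_pair_basis n hn B hBsymm hBadj hBoff (basisVec v)] at h
    simp [basisVec, h1, h2] at h
    have h' : pairQ B K (basisVec v) = pairQ B K (fun w => if w = v then 1 else 0) := rfl
    rw [h']; linarith
  have e1 : pairQ B x lpa = pairQ B lpa x := cusp_pair_symm B hBsymm _ _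
  have e2 : pairQ B x K = pairQ B K x := cusp_pair_symm B hBsymm _ _
  have e3 : chiQ B K (lpa + x) - chiQ B K lpa =
      -(2 * pairQ B lpa x + pairQ B x x + pairQ B K x) / 2 := by
    unfold chiQ
    simp only [cusp_pair_add_left, cusp_pair_add_right, e1, e2]
    ring
  rw [e3, cusp_pair_right B lpa x, cusp_pair_right B x x, cusp_pair_right B K x]
  simp only [hlpa, hKv, cusp_pair_basis n hn B hBsymm hBadj hBoff x]
  rw [Finset.mul_sum, ← Finset.sum_add_distrib, ← Finset.sum_add_distrib, ← Finset.sum_neg_distrib,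
    Finset.sum_div]
  refine Finset.sum_congr rfl fun v _ => ?_
  ring

/-- **Case (a) of the coefficient computation for cusps.**
For a cusp graph (cycle) on `n ≥ 3` vertices and `a = k·δ_{v₀}` with `k ≥ 1`,
`∑_{I ⊆ V} (-1)^{|I|+1} χ(l'_a + E_{J(a,I)}) = 1`. -/
theorem cusp_coeff_case_a (n : ℕ) (hn : 3 ≤ n) [NeZero n]
    (B : ZMod n → ZMod n → ℤ)
    (hBsymm : ∀ i j, B i j = B j i)
    (hBdiag : ∀ i, B i i ≤ -2)
    (hBadj : ∀ i, B i (i + 1) = 1)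
    (hBoff : ∀ i j, i ≠ j → j ≠ i + 1 → j ≠ i - 1 → B i j = 0)
    (hposdef : ∀ x : ZMod n → ℚ, x ≠ 0 → pairQ B x x < 0)
    (K : ZMod n → ℚ)
    (hK : ∀ v, pairQ B (K + basisVec v) (basisVec v) = -2)
    (a : ZMod n → ℕ)
    (lpa : ZMod n → ℚ)
    (hlpa : ∀ v, pairQ B lpa (basisVec v) = -(a v : ℚ))
    (J : Finset (ZMod n) → Finset (ZMod n))
    (hJ : ∀ I, I ⊆ J I ∧
      (∀ v ∉ J I, pairQ B (basisVec v) (lpa + EJ (J I)) ≤ 0) ∧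
      ∀ J' : Finset (ZMod n), I ⊆ J' →
        (∀ v ∉ J', pairQ B (basisVec v) (lpa + EJ J') ≤ 0) → J I ⊆ J')
    (v0 : ZMod n) (k : ℕ) (hk : 1 ≤ k)
    (ha : a = fun w => if w = v0 then k else 0) :
    ∑ I ∈ Finset.univ.powerset,
      (-1 : ℚ) ^ (I.card + 1) * chiQ B K (lpa + EJ (J I)) = 1 := by
  classical
  subst ha
  have hcond : ∀ (S : Finset (ZMod n)) (v : ZMod n), v ∉ S →
      pairQ B (basisVec v) (lpa + EJ S) = -(if v = v0 then (k : ℚ) else 0)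
        + (if v + 1 ∈ S then 1 else 0) + (if v - 1 ∈ S then 1 else 0) := by
    intro S v hv
    rw [cusp_pair_symm B hBsymm, cusp_pair_add_left, hlpa,
      cusp_pair_basis n hn B hBsymm hBadj hBoff (EJ S)]
    simp only [EJ, hv, if_false]
    push_cast
    ring
  have hk' : (1 : ℚ) ≤ k := by exact_mod_cast hk
  -- propagation
  have hprop : ∀ I w, w ∈ J I → ∀ u, u ≠ v0 → u ∈ J I := by
    intro I w hw
    refine cusp_prop n v0 (J I) ?_ w hw
    intro v hv hv0
    have h := (hJ I).2.1 v hv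
    rw [hcond _ _ hv, if_neg hv0] at h
    constructor <;> intro hm <;> rw [if_pos hm] at h <;> split_ifs at h <;> norm_num at h
  have hfull : ∀ I, v0 ∈ I → J I = Finset.univ := by
    intro I hI
    have h0 := (hJ I).1 hI
    ext u
    simp only [Finset.mem_univ, iff_true]
    by_cases hu : u = v0
    · exact hu ▸ h0
    · exact hprop I v0 h0 u hu
  have hempty : J ∅ = ∅ := by
    have := (hJ ∅).2.2 ∅ (by simp) (by
      intro v hv
      rw [hcond _ _ hv]
      simp only [Finset.notMem_empty, if_false]
      split_ifs <;> linarith)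
    exact Finset.subset_empty.mp this
  obtain ⟨hv1, hv2, hv3⟩ := cusp_ne n hn v0
  have hdiff := cusp_chi_diff n hn B hBsymm hBadj hBoff K hK _ lpa hlpa
  have hE0 : lpa + EJ (∅ : Finset (ZMod n)) = lpa := by
    ext v; simp [EJ]
  have hc : ∀ I : Finset (ZMod n), I.Nonempty → v0 ∉ I →
      chiQ B K (lpa + EJ (J I)) = chiQ B K lpa + 1 := by
    rintro I ⟨w, hw⟩ hv0
    have hall := hprop I w ((hJ I).1 hw)
    rw [← sub_eq_iff_eq_add', hdiff]
    rcases Nat.lt_or_ge k 2 with hk2 | hk2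
    · have hk1 : k = 1 := by omega
      subst hk1
      have hJI : J I = Finset.univ := by
        ext u
        simp only [Finset.mem_univ, iff_true]
        by_cases hu : u = v0
        · subst hu
          by_contra hn0
          have h := (hJ I).2.1 _ hn0
          rw [hcond _ _ hn0, if_pos rfl, if_pos (hall _ hv1), if_pos (hall _ hv2)] at h
          norm_num at h
        · exact hall u hu
      rw [hJI]
      have : ∀ v : ZMod n, EJ (Finset.univ : Finset (ZMod n)) v = 1 := fun v => by simp [EJ]
      simp only [this]
      rw [Finset.sum_congr rfl (g := fun v => if v = v0 then (1 : ℚ) else 0)]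
      · simp
      · intro v _
        split_ifs <;> push_cast <;> ring
    · have hk2' : (2 : ℚ) ≤ k := by exact_mod_cast hk2
      have hJI : J I = Finset.univ.erase v0 := by
        apply Finset.Subset.antisymm
        · apply (hJ I).2.2
          · intro u hu
            simp only [Finset.mem_erase, Finset.mem_univ, and_true]
            rintro rfl
            exact hv0 hu
          · intro v hv
            have : v = v0 := by simpa using hv
            subst this
            rw [hcond _ _ hv, if_pos rfl]
            split_ifs <;> linarith
        · intro u hu
          exact hall u (by simpa using hu)
      rw [hJI]
      have hE : ∀ v : ZMod n, EJ (Finset.univ.erase v0) v = 1 - if v = v0 then (1 : ℚ) else 0 := by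
        intro v
        by_cases h : v = v0 <;> simp [EJ, h]
      simp only [hE]
      rw [Finset.sum_congr rfl (g := fun v => (if v = v0 - 1 then (1/2 : ℚ) else 0)
        + (if v = v0 + 1 then (1/2 : ℚ) else 0))]
      · rw [Finset.sum_add_distrib]; simp; norm_num
      · intro v _
        by_cases h : v = v0
        · subst h
          simp [hv1.symm, hv2.symm]
        · simp only [h, if_false, eq_sub_iff_add_eq, ← sub_eq_iff_eq_add]
          split_ifs <;> push_cast <;> ring
  have hsplit : (Finset.univ : Finset (ZMod n)) = insert v0 (Finset.univ.erase v0) := by simp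
  rw [hsplit, Finset.sum_powerset_insert (by simp), ← Finset.sum_add_distrib]
  have hterm : ∀ I ∈ (Finset.univ.erase v0).powerset,
      (-1 : ℚ) ^ (I.card + 1) * chiQ B K (lpa + EJ (J I)) +
        (-1 : ℚ) ^ ((insert v0 I).card + 1) * chiQ B K (lpa + EJ (J (insert v0 I)))
      = (-1 : ℚ) ^ I.card * (chiQ B K (lpa + EJ Finset.univ) - (chiQ B K lpa + 1))
        + if I = ∅ then 1 else 0 := by
    intro I hI
    have hv0 : v0 ∉ I := fun h => by
      have := Finset.mem_powerset.mp hI h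
      simp at this
    rw [hfull _ (Finset.mem_insert_self v0 I), Finset.card_insert_of_notMem hv0]
    by_cases h : I = ∅
    · subst h
      rw [hempty, hE0]; simp; ring
    · rw [hc I (Finset.nonempty_iff_ne_empty.mpr h) hv0, if_neg h]; ring
  rw [Finset.sum_congr rfl hterm, Finset.sum_add_distrib, ← Finset.sum_mul]
  have hz : ∑ I ∈ (Finset.univ.erase v0).powerset, (-1 : ℚ) ^ I.card = 0 := by
    have := Finset.sum_powerset_neg_one_pow_card_of_nonempty
      (x := (Finset.univ.erase v0 : Finset (ZMod n))) ⟨v0 + 1, by simpa using hv1⟩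
    exact_mod_cast this
  rw [hz]
  simp
end

section
/- Let n ≥ 3, let R = Z[x_i : i ∈ Z/nZ], and in R[L] set N(L) = Π_{i ∈ Z/n} (1 − x_i − x_{i+1} + L·x_i x_{i+1}) and D(L) = Π_{i ∈ Z/n} (1 − x_i)(1 − L·x_i). Then: (i) N(1) = D(1); and (ii) the derivative of N − D with respect to L, evaluated at L = 1, equals Σ_{i ∈ Z/n} x_i(1 − x_i) Π_{j ≠ i} (1 − x_j)² + Σ_{i ∈ Z/n} x_i x_{i+1} (1 − x_i)(1 − x_{i+1}) Π_{j ≠ i, i+1} (1 − x_j)². (This polynomial identity is the computational content of the formula P(t) = Z(t) = 1 + Σ_v t^{E*_v}/(1−t^{E*_v}) + Σ_{(u,v)∈E} t^{E*_v}/(1−t^{E*_v}) · t^{E*_u}/(1−t^{E*_u}) for a cusp with n ≥ 3 exceptional curves, obtained from Z(L,t) = 1 + (Z^{ECa}(L,t) − 1)/(L − 1) by setting L = 1.) -/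
open Finset

theorem eval_deriv_prod_aux {S ι : Type*} [CommRing S] [Fintype ι] [DecidableEq ι]
    (f : ι → Polynomial S) (g d : ι → S) (hg : ∀ i, Polynomial.eval 1 (f i) = g i)
    (hd : ∀ i, Polynomial.eval 1 (Polynomial.derivative (f i)) = d i) :
    Polynomial.eval 1 (Polynomial.derivative (∏ i, f i)) =
      ∑ i, (∏ j ∈ Finset.univ.erase i, g j) * d i := by
  rw [Polynomial.derivative_prod_finset, Polynomial.eval_finsetSum]
  simp only [Polynomial.eval_mul, Polynomial.eval_prod, hg, hd]

theorem cusp_aux (n : ℕ) (hn : 3 ≤ n) [NeZero n] {R : Type*} [CommRing R] (x : ZMod n → R) :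
    let N : Polynomial R := ∏ i : ZMod n,
      (1 - Polynomial.C (x i) - Polynomial.C (x (i + 1)) +
        Polynomial.X * Polynomial.C (x i * x (i + 1)))
    let D : Polynomial R := ∏ i : ZMod n,
      (1 - Polynomial.C (x i)) * (1 - Polynomial.X * Polynomial.C (x i))
    Polynomial.eval 1 N = Polynomial.eval 1 D ∧
    Polynomial.eval 1 (Polynomial.derivative (N - D)) =
      (∑ i : ZMod n, x i * (1 - x i) * ∏ j ∈ Finset.univ.erase i, (1 - x j) ^ 2) +
      ∑ i : ZMod n, x i * x (i + 1) * (1 - x i) * (1 - x (i + 1)) *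
        ∏ j ∈ Finset.univ \ {i, i + 1}, (1 - x j) ^ 2 := by
  intro N D
  have hne : ∀ i : ZMod n, i ≠ i + 1 := by
    intro i h
    have h1 : (1 : ZMod n) = 0 := by
      have h2 : i + 0 = i + 1 := by rw [add_zero]; exact h
      exact (add_left_cancel h2).symm
    have : Fact (1 < n) := ⟨by omega⟩
    exact one_ne_zero h1
  have hN : ∀ i : ZMod n, Polynomial.eval 1 (1 - Polynomial.C (x i) - Polynomial.C (x (i + 1)) +
        Polynomial.X * Polynomial.C (x i * x (i + 1))) = (1 - x i) * (1 - x (i + 1)) := by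
    intro i
    simp only [Polynomial.eval_add, Polynomial.eval_sub, Polynomial.eval_mul,
      Polynomial.eval_C, Polynomial.eval_X, Polynomial.eval_one]
    ring
  have hD : ∀ i : ZMod n, Polynomial.eval 1 ((1 - Polynomial.C (x i)) *
      (1 - Polynomial.X * Polynomial.C (x i))) = (1 - x i) ^ 2 := by
    intro i
    simp only [Polynomial.eval_sub, Polynomial.eval_mul,
      Polynomial.eval_C, Polynomial.eval_X, Polynomial.eval_one]
    ring
  have hN' : ∀ i : ZMod n, Polynomial.eval 1 (Polynomial.derivative
      (1 - Polynomial.C (x i) - Polynomial.C (x (i + 1)) +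
        Polynomial.X * Polynomial.C (x i * x (i + 1)))) = x i * x (i + 1) := by
    intro i
    simp [-map_mul]
  have hD' : ∀ i : ZMod n, Polynomial.eval 1 (Polynomial.derivative
      ((1 - Polynomial.C (x i)) * (1 - Polynomial.X * Polynomial.C (x i)))) =
      - (x i * (1 - x i)) := by
    intro i
    simp
    ring
  have key : ∀ i : ZMod n, ∏ j ∈ Finset.univ.erase i, ((1 - x j) * (1 - x (j + 1))) =
      (1 - x i) * (1 - x (i + 1)) * ∏ j ∈ Finset.univ \ {i, i + 1}, (1 - x j) ^ 2 := by
    intro i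
    have e1 : ∏ j ∈ Finset.univ.erase i, (1 - x (j + 1)) =
        ∏ j ∈ Finset.univ.erase (i + 1), (1 - x j) :=
      Finset.prod_equiv (Equiv.addRight 1) (by intro j; simp) (by intro j _; simp)
    have e2 : (Finset.univ.erase i).erase (i + 1) = Finset.univ \ {i, i + 1} := by
      ext j; simp; tauto
    have e3 : (Finset.univ.erase (i + 1)).erase i = Finset.univ \ {i, i + 1} := by
      ext j; simp
    rw [Finset.prod_mul_distrib, e1,
      ← Finset.mul_prod_erase (Finset.univ.erase i) (fun j => 1 - x j) (a := i + 1)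
        (by simp [(hne i).symm]),
      ← Finset.mul_prod_erase (Finset.univ.erase (i + 1)) (fun j => 1 - x j) (a := i)
        (by simp [hne i]), e2, e3, Finset.prod_pow]
    ring
  constructor
  · simp only [N, D, Polynomial.eval_prod, hN, hD]
    rw [Finset.prod_mul_distrib, Finset.prod_pow, sq]
    congr 1
    exact Fintype.prod_equiv (Equiv.addRight 1) _ _ (by intro j; simp)
  · rw [Polynomial.derivative_sub, Polynomial.eval_sub]
    have a1 := eval_deriv_prod_aux _ _ _ hN hN'
    have a2 := eval_deriv_prod_aux _ _ _ hD hD'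
    refine (congrArg₂ (· - ·) a1 a2).trans ?_
    simp only [key]
    rw [sub_eq_add_neg, ← Finset.sum_neg_distrib, add_comm]
    congr 1 <;> refine Finset.sum_congr rfl fun i _ => ?_ <;> ring

/-- **The polynomial identity behind `P(t) = Z(t)` for a cusp with `n ≥ 3` components.**
In `R[L]` with `R = ℤ[x_i : i ∈ ℤ/n]`, let
`N(L) = ∏_i (1 - x_i - x_{i+1} + L x_i x_{i+1})` and `D(L) = ∏_i (1 - x_i)(1 - L x_i)`.
Then `N(1) = D(1)` and the derivative of `N - D` at `L = 1` equals
`∑_i x_i(1-x_i) ∏_{j≠i} (1-x_j)² + ∑_i x_i x_{i+1}(1-x_i)(1-x_{i+1}) ∏_{j∉{i,i+1}} (1-x_j)²`. -/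
theorem cusp_motivic_polynomial_identity (n : ℕ) (hn : 3 ≤ n) [NeZero n] :
    let R := MvPolynomial (ZMod n) ℤ
    let x : ZMod n → R := MvPolynomial.X
    let N : Polynomial R := ∏ i : ZMod n,
      (1 - Polynomial.C (x i) - Polynomial.C (x (i + 1)) +
        Polynomial.X * Polynomial.C (x i * x (i + 1)))
    let D : Polynomial R := ∏ i : ZMod n,
      (1 - Polynomial.C (x i)) * (1 - Polynomial.X * Polynomial.C (x i))
    Polynomial.eval 1 N = Polynomial.eval 1 D ∧
    Polynomial.eval 1 (Polynomial.derivative (N - D)) =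
      (∑ i : ZMod n, x i * (1 - x i) * ∏ j ∈ Finset.univ.erase i, (1 - x j) ^ 2) +
      ∑ i : ZMod n, x i * x (i + 1) * (1 - x i) * (1 - x (i + 1)) *
        ∏ j ∈ Finset.univ \ {i, i + 1}, (1 - x j) ^ 2 := by
  exact cusp_aux n hn (R := MvPolynomial (ZMod n) ℤ) MvPolynomial.X
end

section
/- Let V be a nonempty finite set, E a finite edge set with endpoint maps ε₁, ε₂ : E → V (loops and multiple edges allowed), and let κ_v = #{e : ε₁(e) = v} + #{e : ε₂(e) = v} be the valency of v. Let F be a field and ℓ ∈ F, (x_v)_{v∈V} ∈ F^V with 1 − x_v ≠ 0 and 1 − ℓx_v ≠ 0 for all v. Then Π_{v∈V} (1 − x_v)^{κ_v − 1} / (1 − ℓ x_v) · Π_{e∈E} ( 1 + (ℓ − 1)·x_{ε₁e} x_{ε₂e} / ((1 − x_{ε₁e})(1 − x_{ε₂e})) ) = Π_{e∈E} (1 − x_{ε₁e} − x_{ε₂e} + ℓ x_{ε₁e} x_{ε₂e}) / Π_{v∈V} (1 − x_v)(1 − ℓ x_v), where the exponent κ_v − 1 is an integer power in the field F. (This is the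 rational-function identity proving the closed formula Z^{ECa}(L,t) = Π_{(u,v)∈E}(1 − t^{E*_u} − t^{E*_v} + L t^{E*_u + E*_v}) / Π_{v∈V}(1 − t^{E*_v})(1 − L t^{E*_v}) from the stratified count of effective Cartier divisors.) -/
open Finset

/-- The valency `κ_v` of a vertex `v` in a finite graph with edge set `E` and endpoint
maps `ε₁, ε₂ : E → V` (loops and multiple edges allowed). -/
def valency {V E : Type*} [Fintype E] [DecidableEq V] (eps1 eps2 : E → V) (v : V) : ℕ :=
  (Finset.univ.filter fun e => eps1 e = v).card +
    (Finset.univ.filter fun e => eps2 e = v).card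

/-- **The rational-function identity behind the closed formula for `Z^{ECa}(L,t)`.**
For a finite graph `(V, E, ε₁, ε₂)` with `V ≠ ∅`, a field `F`, and `ℓ, (x_v)` in `F` with
`1 - x_v ≠ 0` and `1 - ℓx_v ≠ 0` for all `v`:
`∏_v (1-x_v)^{κ_v-1}/(1-ℓx_v) · ∏_e (1 + (ℓ-1) x_{ε₁e}x_{ε₂e}/((1-x_{ε₁e})(1-x_{ε₂e})))`
equals `∏_e (1 - x_{ε₁e} - x_{ε₂e} + ℓ x_{ε₁e}x_{ε₂e}) / ∏_v (1-x_v)(1-ℓx_v)`. -/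
theorem ECa_series_closed_formula {V E : Type*} [Fintype V] [DecidableEq V] [Nonempty V]
    [Fintype E] (eps1 eps2 : E → V)
    (F : Type*) [Field F] (l : F) (x : V → F)
    (hx1 : ∀ v, 1 - x v ≠ 0) (hx2 : ∀ v, 1 - l * x v ≠ 0) :
    (∏ v : V, (1 - x v) ^ ((valency eps1 eps2 v : ℤ) - 1) / (1 - l * x v)) *
      ∏ e : E, (1 + (l - 1) *
        (x (eps1 e) * x (eps2 e) / ((1 - x (eps1 e)) * (1 - x (eps2 e))))) =
    (∏ e : E, (1 - x (eps1 e) - x (eps2 e) + l * x (eps1 e) * x (eps2 e))) /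
      ∏ v : V, (1 - x v) * (1 - l * x v) := by
  have key : ∀ f : E → V, ∏ v : V, (1 - x v) ^ (Finset.univ.filter fun e => f e = v).card
      = ∏ e : E, (1 - x (f e)) := by
    intro f
    rw [← Finset.prod_fiberwise (s := Finset.univ) (g := f)]
    refine Finset.prod_congr rfl fun v _ => ?_
    rw [← Finset.prod_const]
    refine Finset.prod_congr rfl fun e he => ?_
    rw [(Finset.mem_filter.mp he).2]
  have h1 : ∀ v : V, (1 - x v) ^ ((valency eps1 eps2 v : ℤ) - 1) / (1 - l * x v) =
      ((1 - x v) ^ (Finset.univ.filter fun e => eps1 e = v).card *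
       (1 - x v) ^ (Finset.univ.filter fun e => eps2 e = v).card) /
        ((1 - x v) * (1 - l * x v)) := by
    intro v
    rw [zpow_sub_one₀ (hx1 v), zpow_natCast, valency, pow_add, ← div_eq_mul_inv, div_div]
  rw [Finset.prod_congr rfl fun v _ => h1 v, Finset.prod_div_distrib, Finset.prod_mul_distrib,
    key, key, div_mul_eq_mul_div, ← Finset.prod_mul_distrib, ← Finset.prod_mul_distrib]
  congr 1
  refine Finset.prod_congr rfl fun e _ => ?_
  have a := hx1 (eps1 e)
  have b := hx1 (eps2 e)
  field_simp
  ring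
end

section
/- Let V be a nonempty finite set, E a finite edge set with endpoint maps ε₁, ε₂ : E → V (loops and multiple edges allowed), and κ_v = #{e : ε₁(e) = v} + #{e : ε₂(e) = v}. Let F be a field and ℓ ∈ F, (x_v)_{v∈V} ∈ F^V with ℓ ≠ 0, x_v ≠ 0, 1 − x_v ≠ 0 and 1 − ℓx_v ≠ 0 for all v. Define F(ℓ, (y_v)) = Π_{e∈E}(1 − y_{ε₁e} − y_{ε₂e} + ℓ y_{ε₁e} y_{ε₂e}) / Π_{v∈V}(1 − y_v)(1 − ℓ y_v). Then ℓ^{|E| − |V|} · Π_{v∈V} x_v^{κ_v − 2} · F(ℓ, ((ℓ x_v)^{−1})_{v∈V}) = F(ℓ, (x_v)_{v∈V}), where exponents are integer powers in F. (For a connected graph, |E| − |V| = c(Γ) − 1 where c(Γ) is the number of independent cycles, and Π_v x_v^{κ_v − 2} = t^{Z_K − E}; this is the functional equation L^{c(Γ)−1} t^{Z_K−E} Z(L,t)|_{t_v ↦ (L t_v)^{−1}} = Z(L,t) of the motivic series.) -/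
open Finset

/-- The rational function
`F(ℓ, y) = ∏_e (1 - y_{ε₁e} - y_{ε₂e} + ℓ y_{ε₁e}y_{ε₂e}) / ∏_v (1 - y_v)(1 - ℓy_v)`. -/
def motivicZ {V E : Type*} [Fintype V] [Fintype E] (eps1 eps2 : E → V)
    (F : Type*) [Field F] (l : F) (y : V → F) : F :=
  (∏ e : E, (1 - y (eps1 e) - y (eps2 e) + l * y (eps1 e) * y (eps2 e))) /
    ∏ v : V, (1 - y v) * (1 - l * y v)

theorem prod_fib {V E : Type*} [Fintype V] [DecidableEq V] [Fintype E] (f : E → V)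
    {F : Type*} [Field F] (x : V → F) :
    ∏ v : V, x v ^ (Finset.univ.filter fun e => f e = v).card = ∏ e : E, x (f e) := by
  rw [← Finset.prod_fiberwise (s := Finset.univ) (g := f)]
  refine Finset.prod_congr rfl fun v _ => ?_
  rw [Finset.prod_congr rfl (g := fun _ => x v)]
  · simp
  · intro e he
    rw [(Finset.mem_filter.mp he).2]

/-- **The functional equation of the motivic series.** For a finite graph `(V, E, ε₁, ε₂)`
with `V ≠ ∅`, a field `F` and `ℓ ≠ 0`, `x_v ≠ 0`, `1 - x_v ≠ 0`, `1 - ℓx_v ≠ 0`: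
`ℓ^{|E|-|V|} · ∏_v x_v^{κ_v-2} · F(ℓ, ((ℓx_v)⁻¹)_v) = F(ℓ, (x_v)_v)`. -/
theorem motivic_functional_equation {V E : Type*} [Fintype V] [DecidableEq V] [Nonempty V]
    [Fintype E] (eps1 eps2 : E → V)
    (F : Type*) [Field F] (l : F) (x : V → F)
    (hl : l ≠ 0) (hx0 : ∀ v, x v ≠ 0)
    (hx1 : ∀ v, 1 - x v ≠ 0) (hx2 : ∀ v, 1 - l * x v ≠ 0) :
    l ^ ((Fintype.card E : ℤ) - (Fintype.card V : ℤ)) *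
      (∏ v : V, x v ^ ((valency eps1 eps2 v : ℤ) - 2)) *
      motivicZ eps1 eps2 F l (fun v => (l * x v)⁻¹) =
    motivicZ eps1 eps2 F l x := by
  have hV : ∏ v : V, x v ^ ((valency eps1 eps2 v : ℤ) - 2) =
      (∏ e : E, x (eps1 e) * x (eps2 e)) / ∏ v : V, x v ^ 2 := by
    rw [Finset.prod_mul_distrib, ← prod_fib eps1 x, ← prod_fib eps2 x,
      ← Finset.prod_mul_distrib, ← Finset.prod_div_distrib]
    refine Finset.prod_congr rfl fun v _ => ?_
    rw [zpow_sub₀ (hx0 v), zpow_natCast, valency, pow_add]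
    norm_cast
  have hE : ∏ e : E, (1 - x (eps1 e) - x (eps2 e) + l * x (eps1 e) * x (eps2 e)) =
      l ^ Fintype.card E * (∏ e : E, x (eps1 e) * x (eps2 e)) *
      ∏ e : E, (1 - (l * x (eps1 e))⁻¹ - (l * x (eps2 e))⁻¹ +
        l * (l * x (eps1 e))⁻¹ * (l * x (eps2 e))⁻¹) := by
    rw [← Finset.card_univ, ← Finset.prod_const, ← Finset.prod_mul_distrib,
      ← Finset.prod_mul_distrib]
    refine Finset.prod_congr rfl fun e _ => ?_
    have h1 := hx0 (eps1 e)
    have h2 := hx0 (eps2 e)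
    field_simp
    ring
  have hD : ∏ v : V, (1 - x v) * (1 - l * x v) =
      l ^ Fintype.card V * (∏ v : V, x v ^ 2) *
      ∏ v : V, (1 - (l * x v)⁻¹) * (1 - l * (l * x v)⁻¹) := by
    rw [← Finset.card_univ, ← Finset.prod_const, ← Finset.prod_mul_distrib,
      ← Finset.prod_mul_distrib]
    refine Finset.prod_congr rfl fun v _ => ?_
    have h1 := hx0 v
    field_simp
    ring
  unfold motivicZ
  rw [hV, hE, hD, zpow_sub₀ hl, zpow_natCast, zpow_natCast, div_mul_div_comm,
    div_mul_div_comm]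
end

section
/- Let V be a nonempty finite set and B : V × V → Z a symmetric matrix with B(u,v) ≥ 0 whenever u ≠ v, and let c : V → Q. Then for every subset I ⊆ V there exists a unique minimal subset Ī ⊆ V containing I which satisfies property (★); that is, Ī ⊇ I satisfies (★), and every J ⊇ I satisfying (★) contains Ī. (This is the existence and uniqueness part of the generalized Laufer algorithm defining J(l', I).) -/
open Finset

/-- Property (★): `J ⊆ V` satisfies (★) with respect to `c` if for every `v ∉ J` one has
`c(v) + ∑_{w ∈ J} B(v,w) ≤ 0`. -/
def starProp {V : Type*} (B : V → V → ℤ) (c : V → ℚ) (J : Finset V) : Prop :=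
  ∀ v ∉ J, c v + ∑ w ∈ J, (B v w : ℚ) ≤ 0

/-- **Existence and uniqueness in the generalized Laufer algorithm.** For a symmetric
matrix `B` with nonnegative off-diagonal entries and any `c : V → ℚ`, every `I ⊆ V` has a
unique minimal (★)-completion `Ī`: a set containing `I`, satisfying (★), and contained in
every set `J' ⊇ I` satisfying (★). -/
theorem laufer_unique_minimal_completion {V : Type*} [Fintype V] [DecidableEq V] [Nonempty V]
    (B : V → V → ℤ) (hBsymm : ∀ u v, B u v = B v u)
    (hBoff : ∀ u v, u ≠ v → 0 ≤ B u v)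
    (c : V → ℚ) (I : Finset V) :
    ∃! Jbar : Finset V, I ⊆ Jbar ∧ starProp B c Jbar ∧
      ∀ J' : Finset V, I ⊆ J' → starProp B c J' → Jbar ⊆ J' := by
  classical
  let K : Finset V := Finset.univ.filter
    (fun v => ∀ J' : Finset V, I ⊆ J' → starProp B c J' → v ∈ J')
  have hK : ∀ v, v ∈ K ↔ ∀ J' : Finset V, I ⊆ J' → starProp B c J' → v ∈ J' := by
    intro v
    simp [K]
  have hIK : I ⊆ K := fun v hv => (hK v).2 fun J' hI _ => hI hv
  have hmin : ∀ J' : Finset V, I ⊆ J' → starProp B c J' → K ⊆ J' :=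
    fun J' hI hJ v hv => (hK v).1 hv J' hI hJ
  have hstar : starProp B c K := by
    intro v hv
    rw [hK] at hv
    push Not at hv
    obtain ⟨J', hI, hJ, hvJ⟩ := hv
    have h1 := hJ v hvJ
    have h2 : ∑ w ∈ K, (B v w : ℚ) ≤ ∑ w ∈ J', (B v w : ℚ) := by
      apply Finset.sum_le_sum_of_subset_of_nonneg (hmin J' hI hJ)
      intro w hw _
      have hne : v ≠ w := fun h => hvJ (h ▸ hw)
      exact_mod_cast hBoff v w hne
    linarith
  refine ⟨K, ⟨hIK, hstar, hmin⟩, ?_⟩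
  rintro L ⟨h1, h2, h3⟩
  exact Finset.Subset.antisymm (h3 K hIK hstar) (hmin L h1 h2)
end

section
/- Let V be a nonempty finite set and B : V × V → Z a symmetric matrix with B(u,v) ≥ 0 whenever u ≠ v, and let c : V → Q. Let I ⊆ V and let I = I₀ ⊊ I₁ ⊊ ⋯ ⊊ I_k be any sequence of subsets of V such that for each m < k, I_{m+1} = I_m ∪ {v(m)} for some v(m) ∉ I_m with c(v(m)) + Σ_{w∈I_m} B(v(m),w) > 0, and such that the final set I_k satisfies property (★). Then I_k equals the unique minimal subset of V containing I and satisfying (★). (This is the correctness of the generalized Laufer algorithm computing Ī = J(l',I): the result does not depend on the choices made.) -/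
open Finset

/-- **Correctness of the generalized Laufer algorithm.** If `I = I₀ ⊊ I₁ ⊊ ⋯ ⊊ I_k` is any
sequence where `I_{m+1} = I_m ∪ {v(m)}` for some `v(m) ∉ I_m` with
`c(v(m)) + ∑_{w ∈ I_m} B(v(m),w) > 0`, and `I_k` satisfies (★), then `I_k` is the unique
minimal subset containing `I` satisfying (★) — independently of the choices made. -/
theorem laufer_algorithm_correct {V : Type*} [Fintype V] [DecidableEq V] [Nonempty V]
    (B : V → V → ℤ) (hBsymm : ∀ u v, B u v = B v u)
    (hBoff : ∀ u v, u ≠ v → 0 ≤ B u v)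
    (c : V → ℚ) (I : Finset V)
    (k : ℕ) (Iseq : ℕ → Finset V)
    (h0 : Iseq 0 = I)
    (hstep : ∀ m < k, ∃ vm ∉ Iseq m,
      Iseq (m + 1) = insert vm (Iseq m) ∧ 0 < c vm + ∑ w ∈ Iseq m, (B vm w : ℚ))
    (hfinal : starProp B c (Iseq k)) :
    I ⊆ Iseq k ∧ starProp B c (Iseq k) ∧
      ∀ J' : Finset V, I ⊆ J' → starProp B c J' → Iseq k ⊆ J' := by
  refine ⟨?_, hfinal, ?_⟩
  · have key : ∀ m ≤ k, I ⊆ Iseq m := by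
      intro m
      induction m with
      | zero => intro _; rw [h0]
      | succ m ih =>
        intro hm
        obtain ⟨v, _, he, _⟩ := hstep m (by omega)
        rw [he]
        exact (ih (by omega)).trans (Finset.subset_insert _ _)
    exact key k le_rfl
  · intro J hIJ hJ
    have key : ∀ m ≤ k, Iseq m ⊆ J := by
      intro m
      induction m with
      | zero => intro _; rw [h0]; exact hIJ
      | succ m ih =>
        intro hm
        obtain ⟨v, _, he, hpos⟩ := hstep m (by omega)
        have hs := ih (by omega)
        rw [he]
        refine Finset.insert_subset ?_ hs
        by_contra hv
        have h1 := hJ v hv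
        have h2 : ∑ w ∈ Iseq m, (B v w : ℚ) ≤ ∑ w ∈ J, (B v w : ℚ) := by
          refine Finset.sum_le_sum_of_subset_of_nonneg hs ?_
          intro w hw _
          have h3 : v ≠ w := fun h => hv (h ▸ hw)
          exact_mod_cast hBoff v w h3
        linarith
    exact key k le_rfl
end

section
/- Let V be a nonempty finite set and B : V × V → Z a symmetric matrix with B(u,v) ≥ 0 whenever u ≠ v, and let c : V → Q. If J₁ and J₂ are two subsets of V each satisfying property (★), then J₁ ∩ J₂ also satisfies property (★). (This intersection-closure is the key step establishing the uniqueness of the minimal set Ī in the generalized Laufer algorithm.) -/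
open Finset

/-- **Intersection-closure of property (★).** For a symmetric matrix `B` with nonnegative
off-diagonal entries and any `c : V → ℚ`, if `J₁` and `J₂` both satisfy (★), then so does
`J₁ ∩ J₂`. -/
theorem starProp_inter {V : Type*} [Fintype V] [DecidableEq V] [Nonempty V]
    (B : V → V → ℤ) (hBsymm : ∀ u v, B u v = B v u)
    (hBoff : ∀ u v, u ≠ v → 0 ≤ B u v)
    (c : V → ℚ) (J1 J2 : Finset V)
    (h1 : starProp B c J1) (h2 : starProp B c J2) :
    starProp B c (J1 ∩ J2) := by
  have key : ∀ (J : Finset V), starProp B c J → J1 ∩ J2 ⊆ J → ∀ v ∉ J,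
      c v + ∑ w ∈ J1 ∩ J2, (B v w : ℚ) ≤ 0 := by
    intro J hJ hsub v hv
    have hle : ∑ w ∈ J1 ∩ J2, (B v w : ℚ) ≤ ∑ w ∈ J, (B v w : ℚ) := by
      apply Finset.sum_le_sum_of_subset_of_nonneg hsub
      intro w hw _
      have hne : v ≠ w := fun h => hv (h ▸ hw)
      exact_mod_cast hBoff v w hne
    have := hJ v hv
    linarith
  intro v hv
  by_cases hv1 : v ∈ J1
  · exact key J2 h2 Finset.inter_subset_right v
      (fun hv2 => hv (Finset.mem_inter.mpr ⟨hv1, hv2⟩))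
  · exact key J1 h1 Finset.inter_subset_left v hv1
end

section
/- Let V be a nonempty finite set and B : V × V → Z a symmetric matrix with B(u,v) ≥ 0 whenever u ≠ v, and assume that the graph on V with an edge {u,v} whenever u ≠ v and B(u,v) > 0 is connected. Take c ≡ 0. Then every nonempty subset J ⊆ V satisfying property (★) with respect to c ≡ 0 equals V; consequently, for every nonempty I ⊆ V the minimal (★)-completion of I is all of V. (This is the claim J(0, I) = V for nonempty I used in proving that the constant term of the Poincaré series is p(0) = 1.) -/
open Finset

/-- **`J(0, I) = V` for nonempty `I`.** For a symmetric matrix `B` with nonnegative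
off-diagonal entries whose associated graph (edges where `B(u,v) > 0`) is connected, and
`c ≡ 0`, every nonempty `J` satisfying (★) equals `V`; consequently the minimal
(★)-completion of any nonempty `I` is all of `V`. -/
theorem star_completion_of_zero_is_univ {V : Type*} [Fintype V] [DecidableEq V] [Nonempty V]
    (B : V → V → ℤ) (hBsymm : ∀ u v, B u v = B v u)
    (hBoff : ∀ u v, u ≠ v → 0 ≤ B u v)
    (hconn : (SimpleGraph.fromRel fun u v => 0 < B u v).Connected) :
    (∀ J : Finset V, J.Nonempty → starProp B (fun _ => 0) J → J = Finset.univ) ∧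
    ∀ I : Finset V, I.Nonempty → ∀ Jbar : Finset V, I ⊆ Jbar →
      starProp B (fun _ => 0) Jbar →
      (∀ J' : Finset V, I ⊆ J' → starProp B (fun _ => 0) J' → Jbar ⊆ J') →
      Jbar = Finset.univ := by
  have key : ∀ J : Finset V, J.Nonempty → starProp B (fun _ => 0) J → J = Finset.univ := by
    intro J hJ hs
    obtain ⟨a, ha⟩ := hJ
    have step : ∀ x y, (SimpleGraph.fromRel fun u v => 0 < B u v).Adj x y → x ∈ J → y ∈ J := by
      intro x y hxy hx
      by_contra hy
      rw [SimpleGraph.fromRel_adj] at hxy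
      have hpos : 0 < B y x := by
        rcases hxy.2 with h | h
        · rw [hBsymm]; exact h
        · exact h
      have h1 := hs y hy
      have h2 : (B y x : ℚ) ≤ ∑ w ∈ J, (B y w : ℚ) := by
        refine Finset.single_le_sum (f := fun w => (B y w : ℚ)) ?_ hx
        intro w hw
        have : 0 ≤ B y w := hBoff y w (fun h => hy (h ▸ hw))
        exact_mod_cast this
      have h3 : (0 : ℚ) < B y x := by exact_mod_cast hpos
      simp only [zero_add] at h1
      linarith
    have walk : ∀ x y, (SimpleGraph.fromRel fun u v => 0 < B u v).Walk x y → x ∈ J → y ∈ J := by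
      intro x y p
      induction p with
      | nil => exact id
      | cons h _ ih => exact fun hx => ih (step _ _ h hx)
    ext y
    obtain ⟨p⟩ := hconn.preconnected a y
    simpa using walk a y p ha
  exact ⟨key, fun I hI J hIJ hs _ => key J (hI.mono hIJ) hs⟩
end

section
/- Let T be a finite tree (connected acyclic simple graph) on a vertex set V, and let B be a symmetric integer matrix indexed by V with B(u,v) = 1 if u, v are adjacent in T and B(u,v) = 0 for distinct non-adjacent u, v, such that −B is positive definite. Then for every a ∈ Z_{≥0}^V one has Σ_{I ⊆ V} (−1)^{|I|+1} χ(l'_a + E_{J(a,I)}) = Π_{v∈V} (−1)^{a_v} C(κ_v − 2, a_v), where κ_v is the degree of v in T and C(b, a) = b(b−1)⋯(b−a+1)/a! is the generalized binomial coefficient of an integer b. (This identifies the coefficient of t^{l'_a} in Z(t) = Σ_{l'∈S'} Σ_{I⊆V} (−1)^{|I|+1} χ(l' + E_{Ī}) t^{l'} with the corresponding Taylor coefficient of the product Π_v (1 − t^{E*_v})^{κ_v − 2}, for trees of rational curves.) -/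
open Finset

/-- The generalized binomial coefficient `C(b, a) = b(b-1)⋯(b-a+1)/a!` of an integer `b`. -/
def genBinom (b : ℤ) (a : ℕ) : ℚ :=
  (∏ i ∈ Finset.range a, ((b : ℚ) - i)) / (a.factorial : ℚ)

section TreeHelpers

set_option linter.unusedSectionVars false

variable {V : Type*} [Fintype V] [DecidableEq V]

/-- number of neighbours of `v` in `J` -/
def dgT (T : SimpleGraph V) [DecidableRel T.Adj] (J : Finset V) (v : V) : ℕ :=
  (J.filter (fun x => T.Adj v x)).card

/-- the weight function -/
def hT' (T : SimpleGraph V) [DecidableRel T.Adj] (a : V → ℤ) (J : Finset V) : ℚ :=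
  ∑ v ∈ J, (1 + (a v : ℚ)) - (∑ v ∈ J, (dgT T J v : ℚ)) / 2

/-- closedness -/
def ClosedT (T : SimpleGraph V) [DecidableRel T.Adj] (S : Finset V) (a : V → ℤ)
    (J : Finset V) : Prop := ∀ v ∈ S, v ∉ J → (dgT T J v : ℤ) ≤ a v

/-- closure -/
def IsClT (T : SimpleGraph V) [DecidableRel T.Adj] (S : Finset V) (a : V → ℤ)
    (I J : Finset V) : Prop :=
  I ⊆ J ∧ J ⊆ S ∧ ClosedT T S a J ∧ ∀ J', J' ⊆ S → I ⊆ J' → ClosedT T S a J' → J ⊆ J'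

/-- signed binomial -/
def gB (b : ℤ) (a : ℤ) : ℚ := if a < 0 then 0 else (-1) ^ a.toNat * genBinom b a.toNat

lemma genBinom_pascal (b : ℤ) (n : ℕ) :
    genBinom (b + 1) (n + 1) = genBinom b (n + 1) + genBinom b n := by
  unfold genBinom
  rw [Finset.prod_range_succ', Finset.prod_range_succ, Nat.factorial_succ]
  have : ∀ i : ℕ, (((b + 1 : ℤ) : ℚ) - ((i + 1 : ℕ) : ℚ)) = (b : ℚ) - i := by
    intro i; push_cast; ring
  simp only [this]
  have h1 : (n.factorial : ℚ) ≠ 0 := by positivity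
  have h2 : (n + 1 : ℚ) ≠ 0 := by positivity
  push_cast
  field_simp
  ring

lemma gB_pascal (b a : ℤ) : gB (b + 1) a = gB b a - gB b (a - 1) := by
  unfold gB
  rcases lt_trichotomy a 0 with h | h | h
  · rw [if_pos h, if_pos h, if_pos (by omega)]; ring
  · subst h
    simp [genBinom]
  · obtain ⟨n, rfl⟩ : ∃ n : ℕ, a = n + 1 := ⟨(a - 1).toNat, by omega⟩
    rw [if_neg (by omega), if_neg (by omega), if_neg (by omega)]
    have e1 : ((n : ℤ) + 1).toNat = n + 1 := by omega
    have e2 : ((n : ℤ) + 1 - 1).toNat = n := by omega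
    rw [e1, e2, genBinom_pascal]
    ring

lemma gB_zero' (a : ℕ) : gB 0 a = if a = 0 then 1 else 0 := by
  unfold gB genBinom
  rw [if_neg (by omega)]
  cases a with
  | zero => simp
  | succ n => rw [Int.toNat_natCast, Finset.prod_range_succ']; simp

lemma gB_neg_one (a : ℕ) : gB (-1) a = 1 := by
  induction a with
  | zero => simp [gB, genBinom]
  | succ n ih =>
    have := gB_pascal (-1) ((n + 1 : ℕ) : ℤ)
    rw [show (-1 : ℤ) + 1 = 0 by norm_num, gB_zero', if_neg (by omega)] at this
    rw [show (((n + 1 : ℕ) : ℤ) - 1) = n by push_cast; ring, ih] at this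
    linarith

lemma gB_neg_two (a : ℕ) : gB (-2) a = 1 + a := by
  induction a with
  | zero => simp [gB, genBinom]
  | succ n ih =>
    have := gB_pascal (-2) ((n + 1 : ℕ) : ℤ)
    rw [show (-2 : ℤ) + 1 = -1 by norm_num, gB_neg_one] at this
    rw [show (((n + 1 : ℕ) : ℤ) - 1) = n by push_cast; ring, ih] at this
    push_cast at this ⊢
    linarith

variable (T : SimpleGraph V) [DecidableRel T.Adj]

lemma dgT_insert {w : V} {J : Finset V} (hw : w ∉ J) (v : V) :
    dgT T (insert w J) v = dgT T J v + if T.Adj v w then 1 else 0 := by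
  unfold dgT
  rw [Finset.filter_insert]
  split_ifs with h
  · rw [Finset.card_insert_of_notMem (by simp [hw])]
  · simp

lemma dgT_mono {J J' : Finset V} (h : J ⊆ J') (v : V) : dgT T J v ≤ dgT T J' v :=
  Finset.card_le_card (Finset.filter_subset_filter _ h)

lemma hT_insert (a : V → ℤ) {w : V} {J : Finset V} (hw : w ∉ J) :
    hT' T a (insert w J) = hT' T a J + 1 + a w - dgT T J w := by
  unfold hT'
  rw [Finset.sum_insert hw, Finset.sum_insert hw]
  simp only [dgT_insert T hw]
  push_cast
  simp only [Finset.sum_add_distrib]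
  have : ∑ x ∈ J, (if T.Adj x w then (1 : ℚ) else 0) = dgT T J w := by
    simp [dgT, T.adj_comm w]
  rw [this]
  simp
  ring

lemma dgT_leaf {S : Finset V} {w u : V} (hadj : ∀ x ∈ S, T.Adj w x ↔ x = u)
    {J : Finset V} (hJ : J ⊆ S) : dgT T J w = if u ∈ J then 1 else 0 := by
  unfold dgT
  have : J.filter (fun x => T.Adj w x) = J.filter (fun x => x = u) :=
    Finset.filter_congr (fun x hx => hadj x (hJ hx))
  rw [this, Finset.filter_eq']
  split_ifs <;> simp

lemma stepA {S : Finset V} {w u : V} (hw : w ∉ S)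
    (hadj : ∀ x ∈ S, T.Adj w x ↔ x = u) (a : V → ℤ) (ha : 0 ≤ a w) {I J : Finset V}
    (hI : I ⊆ S) (h : IsClT T (insert w S) a I J) :
    IsClT T S a I (J.erase w) ∧ hT' T a J = hT' T a (J.erase w) := by
  obtain ⟨h1, h2, h3, h4⟩ := h
  have hwI : w ∉ I := fun h => hw (hI h)
  have hJS : J.erase w ⊆ S := by
    intro x hx
    rw [Finset.mem_erase] at hx
    exact (Finset.mem_insert.1 (h2 hx.2)).resolve_left hx.1
  have hIJ : I ⊆ J.erase w := Finset.subset_erase.2 ⟨h1, hwI⟩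
  have hcl : ClosedT T S a (J.erase w) := by
    intro v hv hvJ
    have hvw : v ≠ w := fun h => hw (h ▸ hv)
    have hvJ' : v ∉ J := fun h => hvJ (Finset.mem_erase.2 ⟨hvw, h⟩)
    have := h3 v (Finset.mem_insert_of_mem hv) hvJ'
    have := dgT_mono T (Finset.erase_subset w J) v
    omega
  refine ⟨⟨hIJ, hJS, hcl, ?_⟩, ?_⟩
  · intro J' hJ' hIJ' hc
    have hwJ' : w ∉ J' := fun h => hw (hJ' h)
    by_cases hu : u ∈ J'
    · have : J ⊆ insert w J' := by
        apply h4 _ (Finset.insert_subset_insert _ hJ')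
          (hIJ'.trans (Finset.subset_insert _ _))
        intro v hv hvJ
        simp only [Finset.mem_insert, not_or] at hv hvJ
        have hvS := hv.resolve_left hvJ.1
        rw [dgT_insert T hwJ', if_neg]
        · simpa using hc v hvS hvJ.2
        · rw [T.adj_comm, hadj v hvS]; rintro rfl; exact hvJ.2 hu
      rwa [← Finset.subset_insert_iff]
    · have : J ⊆ J' := by
        apply h4 _ (hJ'.trans (Finset.subset_insert _ _)) hIJ'
        intro v hv hvJ
        rcases Finset.mem_insert.1 hv with rfl | hvS
        · rw [dgT_leaf T hadj hJ', if_neg hu]; simpa using ha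
        · exact hc v hvS hvJ
      exact (Finset.erase_subset _ _).trans this
  · by_cases hwJ : w ∈ J
    · have key : u ∈ J.erase w ∧ a w = 0 := by
        by_contra hcon
        have : J ⊆ J.erase w := by
          apply h4 _ (hJS.trans (Finset.subset_insert _ _)) hIJ
          intro v hv hvJ
          rcases Finset.mem_insert.1 hv with rfl | hvS
          · rw [dgT_leaf T hadj hJS]
            split_ifs with hu
            · have : a v ≠ 0 := fun h => hcon ⟨hu, h⟩
              push_cast; omega
            · simpa using ha
          · exact hcl v hvS hvJ
        exact absurd (this hwJ) (Finset.notMem_erase _ _)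
      conv_lhs => rw [← Finset.insert_erase hwJ]
      rw [hT_insert T a (Finset.notMem_erase _ _), dgT_leaf T hadj hJS, if_pos key.1, key.2]
      simp
    · rw [Finset.erase_eq_of_notMem hwJ]

lemma stepB {S : Finset V} {w u : V} (hw : w ∉ S) 
    (hadj : ∀ x ∈ S, T.Adj w x ↔ x = u) (a : V → ℤ) {I J : Finset V}
    (hI : I ⊆ S) (h : IsClT T (insert w S) a (insert w I) J) :
    IsClT T S (fun v => a v - if v = u then 1 else 0) I (J.erase w) ∧
    hT' T a J = hT' T (fun v => a v - if v = u then 1 else 0) (J.erase w) + (1 + a w) := by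
  obtain ⟨h1, h2, h3, h4⟩ := h
  have hwI : w ∉ I := fun h => hw (hI h)
  have hwJ : w ∈ J := h1 (Finset.mem_insert_self _ _)
  have hJS : J.erase w ⊆ S := by
    intro x hx
    rw [Finset.mem_erase] at hx
    exact (Finset.mem_insert.1 (h2 hx.2)).resolve_left hx.1
  have hIJ : I ⊆ J.erase w :=
    Finset.subset_erase.2 ⟨(Finset.subset_insert _ _).trans h1, hwI⟩
  refine ⟨⟨hIJ, hJS, ?_, ?_⟩, ?_⟩
  · intro v hv hvJ
    have hvw : v ≠ w := fun h => hw (h ▸ hv)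
    have hvJ' : v ∉ J := fun h => hvJ (Finset.mem_erase.2 ⟨hvw, h⟩)
    have := h3 v (Finset.mem_insert_of_mem hv) hvJ'
    rw [← Finset.insert_erase hwJ, dgT_insert T (Finset.notMem_erase _ _)] at this
    simp only [T.adj_comm v w, hadj v hv] at this
    push_cast at this
    linarith
  · intro J' hJ' hIJ' hc
    have hwJ' : w ∉ J' := fun h => hw (hJ' h)
    have : J ⊆ insert w J' := by
      apply h4 _ (Finset.insert_subset_insert _ hJ') (Finset.insert_subset_insert _ hIJ')
      intro v hv hvJ
      simp only [Finset.mem_insert, not_or] at hv hvJ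
      have hvS := hv.resolve_left hvJ.1
      rw [dgT_insert T hwJ']
      simp only [T.adj_comm v w, hadj v hvS]
      have := hc v hvS hvJ.2
      push_cast
      linarith
    rwa [← Finset.subset_insert_iff]
  · conv_lhs => rw [← Finset.insert_erase hwJ]
    rw [hT_insert T a (Finset.notMem_erase _ _), dgT_leaf T hadj hJS]
    unfold hT'
    push_cast
    simp only [add_sub, Finset.sum_sub_distrib]
    simp only [Finset.sum_ite_eq']
    ring

lemma sum_pow_insert {w : V} {S : Finset V} (hw : w ∉ S) (F : Finset V → ℚ) :
    ∑ I ∈ (insert w S).powerset, (-1 : ℚ) ^ (I.card + 1) * F I =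
    ∑ I ∈ S.powerset, (-1 : ℚ) ^ (I.card + 1) * F I -
    ∑ I ∈ S.powerset, (-1 : ℚ) ^ (I.card + 1) * F (insert w I) := by
  rw [Finset.sum_powerset_insert hw, sub_eq_add_neg, ← Finset.sum_neg_distrib]
  congr 1
  apply Finset.sum_congr rfl
  intro I hI
  rw [Finset.card_insert_of_notMem (fun h => hw (Finset.mem_powerset.1 hI h))]
  ring

lemma sum_pow_const {S : Finset V} (hS : S.Nonempty) (c : ℚ) :
    ∑ I ∈ S.powerset, (-1 : ℚ) ^ (I.card + 1) * c = 0 := by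
  obtain ⟨w, hw⟩ := hS
  rw [← Finset.insert_erase hw, sum_pow_insert (Finset.notMem_erase _ _) (fun _ => c), sub_self]

lemma neg_case {S : Finset V} (a : V → ℤ) {v : V} (hv : v ∈ S) (ha : a v < 0)
    (J : Finset V → Finset V) (hJ : ∀ I ⊆ S, IsClT T S a I (J I)) (h : Finset V → ℚ) :
    ∑ I ∈ S.powerset, (-1 : ℚ) ^ (I.card + 1) * h (J I) = 0 := by
  rw [← Finset.insert_erase hv, sum_pow_insert (Finset.notMem_erase _ _) (fun I => h (J I)),
    sub_eq_zero]
  apply Finset.sum_congr rfl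
  intro I hI
  have hI : I ⊆ S := (Finset.mem_powerset.1 hI).trans (Finset.erase_subset _ _)
  have hI' : insert v I ⊆ S := Finset.insert_subset hv hI
  obtain ⟨h1, h2, h3, h4⟩ := hJ I hI
  obtain ⟨k1, k2, k3, k4⟩ := hJ _ hI'
  have hvJ : v ∈ J I := by
    by_contra hcon
    have := h3 v hv hcon
    omega
  rw [Finset.Subset.antisymm (h4 _ k2 ((Finset.subset_insert _ _).trans k1) k3)
    (k4 _ h2 (Finset.insert_subset hvJ h1) h3)]

/-- subsets built by adding leaves -/
inductive BT : Finset V → Prop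
  | single (v : V) : BT {v}
  | leaf (S : Finset V) (w u : V) (hw : w ∉ S) (hu : u ∈ S)
      (hadj : ∀ x ∈ S, T.Adj w x ↔ x = u) (hS : BT S) : BT (insert w S)

lemma main_comb {S : Finset V} (hS : BT T S) : ∀ (a : V → ℤ) (J : Finset V → Finset V),
    (∀ I ⊆ S, IsClT T S a I (J I)) →
    ∑ I ∈ S.powerset, (-1 : ℚ) ^ (I.card + 1) * hT' T a (J I) =
    ∏ v ∈ S, gB ((dgT T S v : ℤ) - 2) (a v) := by
  induction hS with
  | single v =>
    intro a J hJ
    by_cases ha : a v < 0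
    · rw [neg_case T a (Finset.mem_singleton_self v) ha J hJ]
      simp [gB, ha]
    · push Not at ha
      have hd : dgT T {v} v = 0 := by
        simp [dgT, Finset.filter_singleton]
      have hd0 : dgT T ∅ v = 0 := by simp [dgT]
      have e1 : J {v} = {v} := by
        obtain ⟨h1, h2, _, _⟩ := hJ {v} (Finset.Subset.refl _)
        exact Finset.Subset.antisymm h2 h1
      have e0 : J ∅ = ∅ := by
        obtain ⟨h1, h2, _, h4⟩ := hJ ∅ (Finset.empty_subset _)
        apply Finset.subset_empty.1
        apply h4 _ (Finset.empty_subset _) (Finset.Subset.refl _)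
        intro x hx _
        rw [Finset.mem_singleton.1 hx, hd0]; simpa using ha
      obtain ⟨n, hn⟩ := Int.eq_ofNat_of_zero_le ha
      have := sum_pow_insert (Finset.notMem_empty v) (fun I => hT' T a (J I))
      simp only [insert_empty_eq, Finset.powerset_empty, Finset.sum_singleton] at this
      rw [this, e0, e1, Finset.prod_singleton, hd, hn]
      simp only [Nat.cast_zero, zero_sub]
      rw [gB_neg_two]
      simp [hT', hd, hn]
  | leaf S w u hw hu hadj hS ih =>
    intro a J hJ
    by_cases ha : a w < 0
    · rw [neg_case T a (Finset.mem_insert_self w S) ha J hJ]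
      rw [Finset.prod_insert hw]
      simp [gB, ha]
    · push Not at ha
      have hA : ∀ I ⊆ S, _ := fun I hI =>
        stepA T hw hadj a ha hI (hJ I (hI.trans (Finset.subset_insert _ _)))
      have hB : ∀ I ⊆ S, _ := fun I hI =>
        stepB T hw hadj a hI (hJ (insert w I) (Finset.insert_subset_insert _ hI))
      rw [sum_pow_insert hw (fun I => hT' T a (J I))]
      have s1 : ∑ I ∈ S.powerset, (-1 : ℚ) ^ (I.card + 1) * hT' T a (J I) =
          ∑ I ∈ S.powerset, (-1 : ℚ) ^ (I.card + 1) * hT' T a ((J I).erase w) :=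
        Finset.sum_congr rfl (fun I hI => by rw [(hA I (Finset.mem_powerset.1 hI)).2])
      have s2 : ∑ I ∈ S.powerset, (-1 : ℚ) ^ (I.card + 1) * hT' T a (J (insert w I)) =
          ∑ I ∈ S.powerset, (-1 : ℚ) ^ (I.card + 1) *
            hT' T (fun v => a v - if v = u then 1 else 0) ((J (insert w I)).erase w) := by
        rw [← add_zero (∑ I ∈ S.powerset, (-1 : ℚ) ^ (I.card + 1) *
            hT' T (fun v => a v - if v = u then 1 else 0) ((J (insert w I)).erase w)),
          ← sum_pow_const ⟨u, hu⟩ (1 + (a w : ℚ)), ← Finset.sum_add_distrib]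
        exact Finset.sum_congr rfl
          (fun I hI => by rw [(hB I (Finset.mem_powerset.1 hI)).2]; ring)
      rw [s1, s2, ih a (fun I => (J I).erase w) (fun I hI => (hA I hI).1),
        ih _ (fun I => (J (insert w I)).erase w) (fun I hI => (hB I hI).1)]
      rw [Finset.prod_insert hw, dgT_insert T hw, dgT_leaf T hadj (Finset.Subset.refl _),
        if_pos hu, if_neg T.irrefl]
      obtain ⟨n, hn⟩ := Int.eq_ofNat_of_zero_le ha
      rw [hn]
      simp only [add_zero, Nat.cast_one]
      rw [show (1 : ℤ) - 2 = -1 by norm_num, gB_neg_one, one_mul]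
      rw [← Finset.mul_prod_erase S _ hu, ← Finset.mul_prod_erase S _ hu,
        ← Finset.mul_prod_erase S _ hu]
      have p1 : ∏ x ∈ S.erase u, gB ((dgT T S x : ℤ) - 2) (a x - if x = u then 1 else 0) =
          ∏ x ∈ S.erase u, gB ((dgT T S x : ℤ) - 2) (a x) :=
        Finset.prod_congr rfl
          (fun x hx => by rw [if_neg (Finset.mem_erase.1 hx).1, sub_zero])
      have p2 : ∏ x ∈ S.erase u, gB ((dgT T (insert w S) x : ℤ) - 2) (a x) =
          ∏ x ∈ S.erase u, gB ((dgT T S x : ℤ) - 2) (a x) :=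
        Finset.prod_congr rfl (fun x hx => by
          rw [Finset.mem_erase] at hx
          rw [dgT_insert T hw, if_neg, add_zero]
          rw [T.adj_comm, hadj x hx.2]; exact hx.1)
      rw [p1, p2, dgT_insert T hw, if_pos ((T.adj_comm _ _).1 ((hadj u hu).2 rfl))]
      rw [show (((dgT T S u + 1 : ℕ) : ℤ) - 2) = ((dgT T S u : ℤ) - 2) + 1 by push_cast; ring,
        gB_pascal]
      simp only [if_true]
      ring

lemma BT_walk {S : Finset V} (hS : BT T S) :
    ∃ r ∈ S, ∀ x ∈ S, ∃ p : T.Walk x r, ∀ y ∈ p.support, y ∈ S := by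
  induction hS with
  | single v =>
    refine ⟨v, by simp, ?_⟩
    intro x hx
    obtain rfl := Finset.mem_singleton.1 hx
    exact ⟨SimpleGraph.Walk.nil, by simp⟩
  | leaf S w u hw hu hadj hS ih =>
    obtain ⟨r, hr, h⟩ := ih
    refine ⟨r, Finset.mem_insert_of_mem hr, ?_⟩
    intro x hx
    rcases Finset.mem_insert.1 hx with rfl | hx
    · obtain ⟨p, hp⟩ := h u hu
      refine ⟨SimpleGraph.Walk.cons ((hadj u hu).2 rfl) p, ?_⟩
      intro y hy
      rw [SimpleGraph.Walk.support_cons, List.mem_cons] at hy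
      rcases hy with rfl | hy
      · simp
      · exact Finset.mem_insert_of_mem (hp y hy)
    · obtain ⟨p, hp⟩ := h x hx
      exact ⟨p, fun y hy => Finset.mem_insert_of_mem (hp y hy)⟩

lemma BT_univ (hT : T.IsTree) : BT T Finset.univ := by
  classical
  obtain ⟨v⟩ := hT.1.nonempty
  obtain ⟨S, hS, hmax⟩ := (Set.toFinite {S : Finset V | BT T S}).exists_maximal
    ⟨{v}, BT.single v⟩
  by_contra hcon
  have hne : S ≠ Finset.univ := fun h => hcon (h ▸ hS)
  obtain ⟨r, hr, hwalk⟩ := BT_walk T hS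
  obtain ⟨z, hz⟩ : ∃ z, z ∉ S := by
    by_contra h; push Not at h; exact hne (Finset.eq_univ_iff_forall.2 h)
  obtain ⟨p⟩ := hT.1.preconnected r z
  obtain ⟨d, -, hd1, hd2⟩ := p.exists_boundary_dart (S : Set V) (by simpa using hr)
    (by simpa using hz)
  have hd1 : d.fst ∈ S := by simpa using hd1
  have hd2 : d.snd ∉ S := by simpa using hd2
  have hB : BT T (insert d.snd S) := by
    refine BT.leaf S d.snd d.fst hd2 hd1 ?_ hS
    intro x hx
    refine ⟨fun hax => ?_, fun h => h ▸ d.adj.symm⟩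
    by_contra hxne
    obtain ⟨q1, hq1⟩ := hwalk x hx
    obtain ⟨q2, hq2⟩ := hwalk d.fst hd1
    let q := (q1.append q2.reverse).bypass
    have hq : ∀ y ∈ q.support, y ∈ S := by
      intro y hy
      have := SimpleGraph.Walk.support_bypass_subset _ hy
      rw [SimpleGraph.Walk.mem_support_append_iff, SimpleGraph.Walk.support_reverse,
        List.mem_reverse] at this
      exact this.elim (hq1 y) (hq2 y)
    let r2 : T.Walk x d.fst :=
      SimpleGraph.Walk.cons hax.symm (SimpleGraph.Walk.cons d.adj.symm SimpleGraph.Walk.nil)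
    have hr2 : r2.IsPath := by
      have h1 := hax.ne
      have h2 := d.adj.ne
      simp [r2, SimpleGraph.Walk.isPath_def, hxne, h1.symm, h2.symm]
    have := hT.2.path_unique ⟨q, SimpleGraph.Walk.bypass_isPath _⟩ ⟨r2, hr2⟩
    have hqr : q = r2 := congrArg Subtype.val this
    apply hd2
    apply hq
    rw [hqr]
    simp [r2]
  exact hd2 (hmax hB (Finset.subset_insert _ _) (Finset.mem_insert_self _ _))

lemma pairQ_comm' {B : V → V → ℤ} (hB : ∀ u v, B u v = B v u) (x y : V → ℚ) :
    pairQ B x y = pairQ B y x := by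
  unfold pairQ
  rw [Finset.sum_comm]
  refine Finset.sum_congr rfl fun i _ => Finset.sum_congr rfl fun j _ => ?_
  rw [hB]; ring

lemma pairQ_add_right' (B : V → V → ℤ) (x y z : V → ℚ) :
    pairQ B x (y + z) = pairQ B x y + pairQ B x z := by
  simp only [pairQ, Pi.add_apply, mul_add, Finset.sum_add_distrib]

lemma pairQ_add_left' (B : V → V → ℤ) (x y z : V → ℚ) :
    pairQ B (x + y) z = pairQ B x z + pairQ B y z := by
  simp only [pairQ, Pi.add_apply, add_mul, Finset.sum_add_distrib]

lemma pairQ_basis (B : V → V → ℤ) (x : V → ℚ) (v : V) :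
    pairQ B x (basisVec v) = ∑ i, x i * (B i v : ℚ) := by
  simp [pairQ, basisVec]

lemma pairQ_EJ (B : V → V → ℤ) (x : V → ℚ) (J : Finset V) :
    pairQ B x (EJ J) = ∑ v ∈ J, pairQ B x (basisVec v) := by
  simp only [pairQ_basis]
  simp only [pairQ, EJ, mul_ite, mul_one, mul_zero]
  rw [Finset.sum_comm, ← Finset.sum_filter_add_sum_filter_not Finset.univ (fun v => v ∈ J)]
  rw [Finset.sum_eq_zero (s := Finset.univ.filter (fun v => v ∉ J))]
  · rw [add_zero]
    simp only [Finset.filter_mem_eq_inter, Finset.univ_inter]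
    exact Finset.sum_congr rfl fun v hv => by simp [hv]
  · intro i hi
    simp only [Finset.mem_filter] at hi
    simp [hi.2]

lemma pairQ_EJ_basis {B : V → V → ℤ}
    (hBsymm : ∀ u v, B u v = B v u)
    (hBadj : ∀ u v, T.Adj u v → B u v = 1)
    (hBnon : ∀ u v, u ≠ v → ¬ T.Adj u v → B u v = 0) (J : Finset V) (v : V) :
    pairQ B (EJ J) (basisVec v) = (if v ∈ J then (B v v : ℚ) else 0) + dgT T J v := by
  rw [pairQ_basis]
  have : ∀ i, EJ J i * (B i v : ℚ) =
      (if i = v then (if v ∈ J then (B v v : ℚ) else 0) else 0) +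
      (if i ∈ J then (if T.Adj v i then 1 else 0) else 0) := by
    intro i
    unfold EJ
    by_cases hi : i = v
    · subst hi; simp
    · by_cases hij : i ∈ J
      · by_cases ha : T.Adj v i
        · simp [hi, hij, ha, hBadj _ _ ha.symm]
        · simp [hi, hij, ha, hBnon i v hi (fun h => ha h.symm)]
      · simp [hi, hij]
  simp only [this, Finset.sum_add_distrib, Finset.sum_ite_eq', Finset.mem_univ, if_true]
  congr 1
  simp [dgT]

end TreeHelpers

/-- **The coefficients of `Z(t)` for a tree of rational curves.** For a tree `T` on `V` with
negative definite symmetric matrix `B` (with `B(u,v) = 1` on edges, `0` off edges), every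
`a ∈ ℤ_{≥0}^V` satisfies
`∑_{I ⊆ V} (-1)^{|I|+1} χ(l'_a + E_{J(a,I)}) = ∏_v (-1)^{a_v} C(κ_v - 2, a_v)`,
identifying the coefficients of `Z(t)` with those of `∏_v (1 - t^{E*_v})^{κ_v - 2}`. -/
theorem tree_Z_coefficient {V : Type*} [Fintype V] [DecidableEq V]
    (T : SimpleGraph V) [DecidableRel T.Adj] (hT : T.IsTree)
    (B : V → V → ℤ)
    (hBsymm : ∀ u v, B u v = B v u)
    (hBadj : ∀ u v, T.Adj u v → B u v = 1)
    (hBnon : ∀ u v, u ≠ v → ¬ T.Adj u v → B u v = 0)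
    (hposdef : ∀ x : V → ℚ, x ≠ 0 → pairQ B x x < 0)
    (K : V → ℚ)
    (hK : ∀ v, pairQ B (K + basisVec v) (basisVec v) = -2)
    (a : V → ℕ)
    (lpa : V → ℚ)
    (hlpa : ∀ v, pairQ B lpa (basisVec v) = -(a v : ℚ))
    (J : Finset V → Finset V)
    (hJ : ∀ I, I ⊆ J I ∧
      (∀ v ∉ J I, pairQ B (basisVec v) (lpa + EJ (J I)) ≤ 0) ∧
      ∀ J' : Finset V, I ⊆ J' →
        (∀ v ∉ J', pairQ B (basisVec v) (lpa + EJ J') ≤ 0) → J I ⊆ J') :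
    ∑ I ∈ Finset.univ.powerset,
      (-1 : ℚ) ^ (I.card + 1) * chiQ B K (lpa + EJ (J I)) =
    ∏ v : V, (-1 : ℚ) ^ (a v) * genBinom ((T.degree v : ℤ) - 2) (a v) := by
  classical
  have hcl : ∀ J' v, v ∉ J' → (pairQ B (basisVec v) (lpa + EJ J') ≤ 0 ↔
      (dgT T J' v : ℤ) ≤ (a v : ℤ)) := by
    intro J' v hv
    rw [pairQ_comm' hBsymm, pairQ_add_left', hlpa, pairQ_EJ_basis T hBsymm hBadj hBnon,
      if_neg hv]
    rw [← @Int.cast_le ℚ]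
    push_cast
    constructor <;> intro h <;> linarith
  have hchi : ∀ J', chiQ B K (lpa + EJ J') = chiQ B K lpa + hT' T (fun v => (a v : ℤ)) J' := by
    intro J'
    have e1 : pairQ B lpa (EJ J') = - ∑ v ∈ J', (a v : ℚ) := by
      rw [pairQ_EJ, ← Finset.sum_neg_distrib]
      exact Finset.sum_congr rfl fun v _ => hlpa v
    have e2 : pairQ B (EJ J') (EJ J') + pairQ B (EJ J') K =
        ∑ v ∈ J', (dgT T J' v : ℚ) - ∑ v ∈ J', (2 : ℚ) := by
      rw [pairQ_comm' hBsymm (EJ J') K, pairQ_EJ, pairQ_EJ, ← Finset.sum_add_distrib,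
        ← Finset.sum_sub_distrib]
      refine Finset.sum_congr rfl fun v hv => ?_
      have h := hK v
      rw [pairQ_add_left'] at h
      have h2 : pairQ B (basisVec v) (basisVec v) = B v v := by
        rw [pairQ_basis]; simp [basisVec]
      rw [pairQ_EJ_basis T hBsymm hBadj hBnon, if_pos hv]
      linarith
    have e3 : ∑ v ∈ J', (2 : ℚ) = 2 * ∑ v ∈ J', (1 : ℚ) := by
      rw [Finset.mul_sum]; simp
    unfold chiQ hT'
    simp only [pairQ_add_left', pairQ_add_right', Finset.sum_add_distrib, Int.cast_natCast]
    rw [pairQ_comm' hBsymm (EJ J') lpa, e1]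
    linarith
  obtain ⟨v0⟩ := hT.1.nonempty
  have key := main_comb T (BT_univ T hT) (fun v => (a v : ℤ)) J (by
    intro I _
    obtain ⟨h1, h2, h3⟩ := hJ I
    refine ⟨h1, Finset.subset_univ _, fun v _ hv => (hcl _ v hv).1 (h2 v hv), ?_⟩
    intro J' _ hI hc
    exact h3 J' hI fun v hv => (hcl _ v hv).2 (hc v (Finset.mem_univ _) hv))
  simp only [hchi, mul_add, Finset.sum_add_distrib]
  rw [sum_pow_const ⟨v0, Finset.mem_univ _⟩, zero_add, key]
  refine Finset.prod_congr rfl fun v _ => ?_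
  have hd : dgT T Finset.univ v = T.degree v := by
    rw [dgT, ← SimpleGraph.card_neighborFinset_eq_degree]
    congr 1; ext x; simp
  rw [hd]
  simp [gB]
end

section
/- Let B be a real symmetric n × n matrix such that −B is positive definite, B_{ij} ≥ 0 for all i ≠ j, and such that the graph on {1,…,n} with an edge {i,j} whenever i ≠ j and B_{ij} > 0 is connected. Then every entry of the inverse matrix B^{−1} is strictly negative; equivalently, each dual basis vector E*_v := −B^{−1} e_v has all coordinates strictly positive in the basis (e_v). (This is the statement that all the entries of the dual base elements E*_v of a connected negative definite plumbing lattice are strictly positive.) -/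
/-- **The dual basis vectors of a connected negative definite plumbing lattice have strictly
positive entries.** If `B` is a real symmetric matrix with `-B` positive definite,
nonnegative off-diagonal entries, and connected associated graph (edges where `B_{ij} > 0`),
then every entry of `B⁻¹` is strictly negative; i.e. each `E*_v = -B⁻¹e_v` has all
coordinates strictly positive. -/
theorem inverse_entries_neg (n : ℕ) (B : Matrix (Fin n) (Fin n) ℝ)
    (hBsymm : B.IsSymm)
    (hposdef : ∀ x : Fin n → ℝ, x ≠ 0 → 0 < dotProduct x ((-B).mulVec x))
    (hBoff : ∀ i j, i ≠ j → 0 ≤ B i j)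
    (hconn : (SimpleGraph.fromRel fun i j : Fin n => 0 < B i j).Connected) :
    ∀ i j, B⁻¹ i j < 0 := by
  have hdet : IsUnit B.det := by
    rw [isUnit_iff_ne_zero]
    intro h0
    obtain ⟨v, hv, hBv⟩ := Matrix.exists_mulVec_eq_zero_iff.mpr h0
    have := hposdef v hv
    rw [Matrix.neg_mulVec, hBv] at this
    simp at this
  intro i j
  obtain ⟨x, hx⟩ : ∃ x : Fin n → ℝ, ∀ i, x i = - B⁻¹ i j := ⟨_, fun _ => rfl⟩
  have hrow : ∀ i, ∑ k, B i k * x k = - (if i = j then 1 else 0) := by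
    intro i
    have h := congrFun (congrFun (Matrix.mul_nonsing_inv B hdet) i) j
    rw [Matrix.mul_apply, Matrix.one_apply] at h
    simp only [hx, mul_neg, Finset.sum_neg_distrib, h]
  have hnn : ∀ i, 0 ≤ x i := by
    obtain ⟨y, hy⟩ : ∃ y : Fin n → ℝ, ∀ i, y i = max (-x i) 0 := ⟨_, fun _ => rfl⟩
    have hy0 : ∀ i, 0 ≤ y i := fun i => by rw [hy]; exact le_max_right _ _
    have hxy : ∀ i, 0 ≤ x i + y i := fun i => by
      have := le_max_left (-x i) 0
      rw [hy]; linarith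
    have hd : ∀ i, y i * (x i + y i) = 0 := fun i => by
      rw [hy]
      rcases le_total (-x i) 0 with h | h
      · rw [max_eq_right h]; ring
      · rw [max_eq_left h]; ring
    have hyz : y = 0 := by
      by_contra hne
      have h1 := hposdef y hne
      have h2 : 0 ≤ ∑ i, y i * ∑ k, B i k * (x k + y k) := by
        refine Finset.sum_nonneg fun i _ => ?_
        rw [Finset.mul_sum]
        refine Finset.sum_nonneg fun k _ => ?_
        by_cases hik : i = k
        · subst hik
          have : y i * (B i i * (x i + y i)) = B i i * (y i * (x i + y i)) := by ring
          rw [this, hd, mul_zero]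
        · exact mul_nonneg (hy0 i) (mul_nonneg (hBoff i k hik) (hxy k))
      simp only [mul_add, Finset.sum_add_distrib, hrow] at h2
      rw [Matrix.neg_mulVec, dotProduct_neg] at h1
      simp only [dotProduct, Matrix.mulVec] at h1
      have h3 : ∑ i, y i * -(if i = j then (1:ℝ) else 0) = - y j := by simp
      have := hy0 j
      linarith
    intro i
    have := hxy i
    rw [hyz] at this
    simpa using this
  have hkey : ∀ a, x a = 0 → a ≠ j ∧ ∀ k, k ≠ a → B a k * x k = 0 := by
    intro a ha
    have hterm : ∀ k ∈ Finset.univ, 0 ≤ B a k * x k := by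
      intro k _
      by_cases hk : a = k
      · subst hk; simp [ha]
      · exact mul_nonneg (hBoff a k hk) (hnn k)
    have hs := Finset.sum_nonneg hterm
    have haj : a ≠ j := by
      intro h
      rw [hrow, if_pos h] at hs
      linarith
    refine ⟨haj, fun k _ => ?_⟩
    have h0 := hrow a
    rw [if_neg haj, neg_zero, Finset.sum_eq_zero_iff_of_nonneg hterm] at h0
    exact h0 k (Finset.mem_univ k)
  have hstep : ∀ a b, (SimpleGraph.fromRel fun i j : Fin n => 0 < B i j).Adj a b →
      x a = 0 → x b = 0 := by
    intro a b hab ha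
    rw [SimpleGraph.fromRel_adj] at hab
    have hB : 0 < B a b := by
      rcases hab.2 with h | h
      · exact h
      · rwa [hBsymm.apply] at h
    exact (mul_eq_zero.mp ((hkey a ha).2 b hab.1.symm)).resolve_left hB.ne'
  have hwalk : ∀ a b, (SimpleGraph.fromRel fun i j : Fin n => 0 < B i j).Walk a b →
      x a = 0 → x b = 0 := by
    intro a b w
    induction w with
    | nil => exact id
    | cons h _ ih => exact fun ha => ih (hstep _ _ h ha)
  have hne : x i ≠ 0 := by
    intro h
    obtain ⟨w⟩ := hconn.preconnected i j
    exact (hkey j (hwalk i j w h)).1 rfl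
  have := lt_of_le_of_ne (hnn i) hne.symm
  rw [hx] at this
  linarith
end

section
/- Let B be an integer symmetric n × n matrix such that −B is positive definite, B_{ij} ≥ 0 for all i ≠ j, and such that the graph on {1,…,n} with an edge {i,j} whenever i ≠ j and B_{ij} > 0 is connected. Then for every c ∈ Q^n, the set { a ∈ Z_{≥0}^n : −B^{−1}a ≱ c } is finite (where x ≥ c means x_i ≥ c_i for all i). Equivalently, for every fixed c, only finitely many elements l' = Σ_v a_v E*_v of the anti-nef cone S' satisfy l' ≱ c. (This is the finiteness property of the anti-nef cone S' used throughout: for any fixed a ∈ L', the set {l' ∈ S' : l' ≱ a} is finite.) -/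
open Finset in
theorem aux_nonneg {n : ℕ} (M : Matrix (Fin n) (Fin n) ℚ)
    (hpos : ∀ x : Fin n → ℚ, x ≠ 0 → 0 < dotProduct x (M.mulVec x))
    (hoff : ∀ i j, i ≠ j → M i j ≤ 0) (x : Fin n → ℚ) (hx : ∀ i, 0 ≤ M.mulVec x i) :
    ∀ i, 0 ≤ x i := by
  by_contra! hneg
  obtain ⟨k, hk⟩ := hneg
  let y : Fin n → ℚ := fun i => max (-x i) 0
  have hy : y ≠ 0 := by
    intro h
    have h1 := congrFun h k
    have h2 : -x k ≤ y k := le_max_left _ _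
    rw [h1] at h2
    simp at h2
    linarith
  have h1 := hpos y hy
  have h2 : 0 ≤ dotProduct y (M.mulVec x) :=
    Finset.sum_nonneg fun i _ => mul_nonneg (le_max_right _ _) (hx i)
  have h3 : dotProduct y (M.mulVec (x + y)) ≤ 0 := by
    refine Finset.sum_nonpos fun i _ => ?_
    simp only [Matrix.mulVec, dotProduct, Finset.mul_sum]
    refine Finset.sum_nonpos fun j _ => ?_
    have hyi : 0 ≤ y i := le_max_right _ _
    have hpj : 0 ≤ (x + y) j := by
      have : -x j ≤ y j := le_max_left _ _
      simp only [Pi.add_apply]; linarith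
    by_cases hij : i = j
    · subst hij
      have : y i * (x + y) i = 0 := by
        simp only [Pi.add_apply, y]
        rcases le_total (-x i) 0 with h | h
        · simp [max_eq_right h]
        · simp [max_eq_left h]
      have e : y i * (M i i * (x + y) i) = M i i * (y i * (x + y) i) := by ring
      rw [e, this, mul_zero]
    · exact mul_nonpos_of_nonneg_of_nonpos hyi
        (mul_nonpos_of_nonpos_of_nonneg (hoff i j hij) hpj)
  rw [Matrix.mulVec_add, dotProduct_add] at h3
  linarith

theorem aux_pos {n : ℕ} (M : Matrix (Fin n) (Fin n) ℚ)
    (hoff : ∀ i j, i ≠ j → M i j ≤ 0) (G : SimpleGraph (Fin n)) (hG : G.Connected)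
    (hadj : ∀ i j, G.Adj i j → M i j < 0)
    (x : Fin n → ℚ) (hx : ∀ i, 0 ≤ M.mulVec x i) (hx0 : ∀ i, 0 ≤ x i) (hne : x ≠ 0) :
    ∀ i, 0 < x i := by
  have step : ∀ i j, G.Adj i j → x i = 0 → x j = 0 := by
    intro i j hij hi
    have hterm : ∀ k ∈ Finset.univ, M i k * x k ≤ 0 := by
      intro k _
      by_cases hik : i = k
      · subst hik; simp [hi]
      · exact mul_nonpos_of_nonpos_of_nonneg (hoff i k hik) (hx0 k)
    have hs : ∑ k, M i k * x k = 0 := le_antisymm (Finset.sum_nonpos hterm) (hx i)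
    have := (Finset.sum_eq_zero_iff_of_nonpos hterm).1 hs j (Finset.mem_univ _)
    rcases mul_eq_zero.1 this with h | h
    · exact absurd h (hadj i j hij).ne
    · exact h
  intro i
  refine lt_of_le_of_ne (hx0 i) fun h => hne ?_
  funext j
  obtain ⟨w⟩ := hG.preconnected i j
  have : ∀ u v : Fin n, G.Walk u v → x u = 0 → x v = 0 := by
    intro u v w
    induction w with
    | nil => exact id
    | cons hh _ ih => exact fun h0 => ih (step _ _ hh h0)
  exact this i j w h.symm

/-- **Finiteness in the anti-nef cone.** If `B` is an integer symmetric matrix with `-B`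
positive definite, nonnegative off-diagonal entries, and connected associated graph, then
for every `c ∈ ℚ^n` the set of `a ∈ ℤ_{≥0}^n` with `-B⁻¹a ≱ c` is finite; i.e. only
finitely many `l' = ∑ a_v E*_v` in the anti-nef cone `S'` satisfy `l' ≱ c`. -/
theorem antinef_cone_finiteness (n : ℕ) (B : Matrix (Fin n) (Fin n) ℤ)
    (hBsymm : B.IsSymm)
    (hposdef : ∀ x : Fin n → ℚ, x ≠ 0 →
      0 < dotProduct x (((-B).map (Int.cast : ℤ → ℚ)).mulVec x))
    (hBoff : ∀ i j, i ≠ j → 0 ≤ B i j)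
    (hconn : (SimpleGraph.fromRel fun i j : Fin n => 0 < B i j).Connected)
    (c : Fin n → ℚ) :
    {a : Fin n → ℕ |
      ¬ c ≤ -((B.map (Int.cast : ℤ → ℚ))⁻¹.mulVec fun i => (a i : ℚ))}.Finite := by
  set A := B.map (Int.cast : ℤ → ℚ) with hA
  have hneg : (-B).map (Int.cast : ℤ → ℚ) = -A := by
    ext i j; simp [hA]
  rw [hneg] at hposdef
  have hdet : IsUnit A.det := by
    rw [isUnit_iff_ne_zero]
    intro h
    obtain ⟨v, hv, hv0⟩ := Matrix.exists_mulVec_eq_zero_iff.2 h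
    have := hposdef v hv
    rw [Matrix.neg_mulVec, hv0] at this
    simp at this
  have hoff : ∀ i j, i ≠ j → (-A) i j ≤ 0 := by
    intro i j hij
    have := hBoff i j hij
    simp only [hA, Matrix.neg_apply, Matrix.map_apply, Left.neg_nonpos_iff]
    exact_mod_cast this
  have hN : ∀ j i, 0 < (-A⁻¹) i j := by
    intro j
    have hmul : (-A).mulVec (fun i => (-A⁻¹) i j) = Pi.single j 1 := by
      have h1 : (-A) * (-A⁻¹) = 1 := by rw [neg_mul_neg, Matrix.mul_nonsing_inv _ hdet]
      funext i
      have h2 := congrFun (congrFun h1 i) j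
      rw [Matrix.mul_apply] at h2
      simp only [Matrix.mulVec, dotProduct]
      rw [h2, Matrix.one_apply, Pi.single_apply]
    have hx : ∀ i, 0 ≤ (-A).mulVec (fun i => (-A⁻¹) i j) i := by
      intro i
      rw [hmul, Pi.single_apply]
      split_ifs <;> norm_num
    refine aux_pos (-A) hoff _ hconn ?_ _ hx (aux_nonneg (-A) hposdef hoff _ hx) ?_
    · intro i k hik
      rw [SimpleGraph.fromRel_adj] at hik
      have : 0 < B i k := by
        rcases hik.2 with h | h
        · exact h
        · rwa [hBsymm.apply] at h
      simp only [hA, Matrix.neg_apply, Matrix.map_apply, Left.neg_neg_iff]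
      exact_mod_cast this
    · intro h
      rw [h, Matrix.mulVec_zero] at hmul
      have := congrFun hmul j
      simp at this
  refine Set.Finite.subset (Set.finite_iUnion fun i : Fin n =>
    Set.finite_Iic (fun j : Fin n => ⌈c i / (-A⁻¹) i j⌉₊)) ?_
  intro a ha
  simp only [Set.mem_setOf_eq, Pi.le_def, not_forall, not_le] at ha
  obtain ⟨i, hi⟩ := ha
  refine Set.mem_iUnion.2 ⟨i, fun j => ?_⟩
  have hle : (-A⁻¹) i j * a j ≤ ∑ k, (-A⁻¹) i k * (a k : ℚ) :=
    Finset.single_le_sum (f := fun k => (-A⁻¹) i k * (a k : ℚ))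
      (fun k _ => mul_nonneg (hN k i).le (Nat.cast_nonneg _)) (Finset.mem_univ j)
  rw [← Matrix.neg_mulVec] at hi
  have hlt : (-A⁻¹) i j * a j < c i := lt_of_le_of_lt hle hi
  have h4 : (a j : ℚ) ≤ c i / (-A⁻¹) i j := by
    rw [le_div_iff₀ (hN j i), mul_comm]; exact hlt.le
  have h5 := h4.trans (Nat.le_ceil _)
  exact_mod_cast h5
end
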